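/- arXiv:1705.05976 — 3 statements merged into one kernel-verified Lean document; each statement's English description precedes it below -/
import Mathlib

section
/- For every detecting order π = (s_1, …, s_V), the sum of the detecting SINRs satisfies Σ_{k=1}^V γ_{s_k} = Σ_{f=1}^F Σ_{t=1}^{d_f} 1/((d_f − t) + λ); in particular, the mean M_π = (1/V) Σ_{k=1}^V γ_{s_k} of the detecting SINR sequence depends only on the factor graph matrix 𝐅 and λ, and not on the detecting order π. -/
open Finset

/-- The set of resources connected to user `v` in the factor graph `A`. -/
def Fv {F V : ℕ} (A : Fin F → Fin V → Bool) (v : Fin V) : Finset (Fin F) :=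
  Finset.univ.filter (fun f => A f v = true)

/-- The degree `d_f` of resource `f`: the number of users connected to it. -/
def deg {F V : ℕ} (A : Fin F → Fin V → Bool) (f : Fin F) : ℕ :=
  (Finset.univ.filter (fun v => A f v = true)).card

/-- The pruned degree `d_f^{(D)}` of resource `f` after the users in `D` are detected. -/
def prunedDeg {F V : ℕ} (A : Fin F → Fin V → Bool) (D : Finset (Fin V)) (f : Fin F) : ℕ :=
  (Finset.univ.filter (fun v => v ∉ D ∧ A f v = true)).card

/-- The instantaneous SINR `γ_v^{(D)}` of an undetected user `v`. -/
noncomputable def gamma {F V : ℕ} (lam : ℝ) (A : Fin F → Fin V → Bool)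
    (D : Finset (Fin V)) (v : Fin V) : ℝ :=
  ∑ f ∈ Fv A v, 1 / (((prunedDeg A D f : ℝ) - 1) + lam)

/-- The detected set `D_{k-1} = {s_1, …, s_{k-1}}` of users occupying positions before `k`
in the detecting order `π` (position `k` maps to user `π k`). -/
def Dset {V : ℕ} (π : Equiv.Perm (Fin V)) (k : Fin V) : Finset (Fin V) :=
  (Finset.univ.filter (fun j => j < k)).image π

/-- The detecting SINR `γ_{s_k} = γ_{s_k}^{(D_{k-1})}` at position `k` of the order `π`. -/
noncomputable def detSINR {F V : ℕ} (lam : ℝ) (A : Fin F → Fin V → Bool)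
    (π : Equiv.Perm (Fin V)) (k : Fin V) : ℝ :=
  gamma lam A (Dset π k) (π k)

/-- `Θ_π`, the sum of squared detecting SINRs. -/
noncomputable def Theta {F V : ℕ} (lam : ℝ) (A : Fin F → Fin V → Bool)
    (π : Equiv.Perm (Fin V)) : ℝ :=
  ∑ k : Fin V, (detSINR lam A π k) ^ 2

/-- `M_π`, the mean of the detecting SINR sequence. -/
noncomputable def Mmean {F V : ℕ} (lam : ℝ) (A : Fin F → Fin V → Bool)
    (π : Equiv.Perm (Fin V)) : ℝ :=
  (1 / (V : ℝ)) * ∑ k : Fin V, detSINR lam A π k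

/-- `V_π`, the variance of the detecting SINR sequence. -/
noncomputable def Vπ {F V : ℕ} (lam : ℝ) (A : Fin F → Fin V → Bool)
    (π : Equiv.Perm (Fin V)) : ℝ :=
  (1 / (V : ℝ)) * (∑ k : Fin V, (detSINR lam A π k) ^ 2) - (Mmean lam A π) ^ 2

/-- Summing a function of the number of elements of `S` that are at least `k`, over `k ∈ S`. -/
theorem sum_card_filter_le {α M : Type*} [LinearOrder α] [AddCommMonoid M]
    (g : ℕ → M) (S : Finset α) :
    ∑ k ∈ S, g (S.filter (fun j => k ≤ j)).card = ∑ t ∈ Finset.Icc 1 S.card, g t := by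
  induction S using Finset.induction_on_min with
  | empty => simp
  | insert a S ha ih =>
    have hnot : a ∉ S := fun h => lt_irrefl a (ha a h)
    have hmin : (insert a S).filter (fun j => a ≤ j) = insert a S :=
      Finset.filter_true_of_mem fun x hx => by
        rcases Finset.mem_insert.mp hx with rfl | hx
        exacts [le_rfl, (ha x hx).le]
    have hrest : ∀ k ∈ S,
        (insert a S).filter (fun j => k ≤ j) = S.filter (fun j => k ≤ j) := fun k hk => by
      rw [Finset.filter_insert, if_neg (not_le.mpr (ha k hk))]
    rw [Finset.sum_insert hnot, hmin, Finset.sum_congr rfl fun k hk => by rw [hrest k hk], ih,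
      Finset.card_insert_of_notMem hnot, Finset.sum_Icc_succ_top (by omega), add_comm]

theorem mem_Dset {V : ℕ} (π : Equiv.Perm (Fin V)) (k j : Fin V) : π j ∈ Dset π k ↔ j < k := by
  simp [Dset]

theorem deg_eq_card_positions {F V : ℕ} (A : Fin F → Fin V → Bool) (π : Equiv.Perm (Fin V))
    (f : Fin F) : deg A f = (Finset.univ.filter (fun j => A f (π j) = true)).card := by
  symm
  exact Finset.card_equiv π (by simp)

theorem prunedDeg_Dset {F V : ℕ} (A : Fin F → Fin V → Bool) (π : Equiv.Perm (Fin V))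
    (k : Fin V) (f : Fin F) :
    prunedDeg A (Dset π k) f =
      ((Finset.univ.filter (fun j => A f (π j) = true)).filter (fun j => k ≤ j)).card := by
  symm
  exact Finset.card_equiv π (by simp [mem_Dset, and_comm])

theorem sum_detSINR {F V : ℕ} (lam : ℝ) (A : Fin F → Fin V → Bool) (π : Equiv.Perm (Fin V)) :
    ∑ k : Fin V, detSINR lam A π k =
      ∑ f : Fin F, ∑ t ∈ Finset.Icc 1 (deg A f), 1 / (((deg A f : ℝ) - (t : ℝ)) + lam) := by
  simp only [detSINR, gamma, Fv, Finset.sum_filter]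
  rw [Finset.sum_comm]
  refine Finset.sum_congr rfl fun f _ => ?_
  simp only [← Finset.sum_filter, prunedDeg_Dset]
  rw [sum_card_filter_le (fun n : ℕ => 1 / (((n : ℝ) - 1) + lam)), ← deg_eq_card_positions]
  refine Finset.sum_nbij' (fun t => deg A f + 1 - t) (fun t => deg A f + 1 - t)
    ?_ ?_ ?_ ?_ ?_ <;> intro t ht <;> rw [Finset.mem_Icc] at ht
  · rw [Finset.mem_Icc]; omega
  · rw [Finset.mem_Icc]; omega
  · omega
  · omega
  · rw [Nat.cast_sub (by omega)]
    push_cast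
    congr 1
    ring

/-- For every detecting order π, the sum of the detecting SINRs equals
`Σ_f Σ_{t=1}^{d_f} 1/((d_f − t) + λ)`; in particular the mean `M_π` depends only on the
factor graph and λ, not on the order. -/
theorem stmt_0 {F V : ℕ} (lam : ℝ) (hlam : 0 < lam) (A : Fin F → Fin V → Bool) :
    (∀ π : Equiv.Perm (Fin V),
      (∑ k : Fin V, detSINR lam A π k) =
        ∑ f : Fin F, ∑ t ∈ Finset.Icc 1 (deg A f),
          1 / (((deg A f : ℝ) - (t : ℝ)) + lam)) ∧
    (∀ π₁ π₂ : Equiv.Perm (Fin V), Mmean lam A π₁ = Mmean lam A π₂) := by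
  refine ⟨sum_detSINR lam A, fun π₁ π₂ => ?_⟩
  rw [Mmean, Mmean, sum_detSINR, sum_detSINR]
end

section
/- (Proposition 1, sufficiency in the two-user case.) Suppose V = 2, with the two detecting orders π_1 = (1,2) and π_2 = (2,1). If γ_1^{(∅)} ≤ γ_2^{(∅)}, then Θ_{π_1} ≥ Θ_{π_2}, i.e., detecting the user with the smaller initial SINR first gives a sum of squared detecting SINRs at least as large as the reverse order. -/
open Finset

/-- In the two-user case, the SINR gained by a user when the other one is detected: each resource
shared by both users contributes `1 / lam - 1 / (1 + lam)`. -/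
noncomputable def sharedGain {F : ℕ} (lam : ℝ) (A : Fin F → Fin 2 → Bool) : ℝ :=
  ∑ f : Fin F, if A f 0 = true ∧ A f 1 = true then 1 / lam - 1 / (1 + lam) else 0

theorem sharedGain_nonneg {F : ℕ} {lam : ℝ} (hlam : 0 < lam) (A : Fin F → Fin 2 → Bool) :
    0 ≤ sharedGain lam A := by
  have hgain : 1 / (1 + lam) ≤ 1 / lam := one_div_le_one_div_of_le hlam (by linarith)
  refine Finset.sum_nonneg fun f _ => ?_
  split_ifs
  · linarith
  · exact le_rfl

theorem prunedDeg_fin_two {F : ℕ} (A : Fin F → Fin 2 → Bool) (D : Finset (Fin 2)) (f : Fin F) :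
    prunedDeg A D f =
      (if 0 ∉ D ∧ A f 0 = true then 1 else 0) + (if 1 ∉ D ∧ A f 1 = true then 1 else 0) := by
  rw [prunedDeg, Finset.card_filter, Fin.sum_univ_two]

theorem gamma_singleton_one_zero {F : ℕ} (lam : ℝ) (A : Fin F → Fin 2 → Bool) :
    gamma lam A {1} 0 = gamma lam A ∅ 0 + sharedGain lam A := by
  unfold gamma Fv sharedGain
  rw [Finset.sum_filter, Finset.sum_filter, ← Finset.sum_add_distrib]
  refine Finset.sum_congr rfl fun f _ => ?_
  have htwo : (2 : ℝ) - 1 = 1 := by norm_num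
  cases h0 : A f 0 <;> cases h1 : A f 1 <;>
    simp [prunedDeg_fin_two, h0, h1, htwo]

theorem gamma_singleton_zero_one {F : ℕ} (lam : ℝ) (A : Fin F → Fin 2 → Bool) :
    gamma lam A {0} 1 = gamma lam A ∅ 1 + sharedGain lam A := by
  unfold gamma Fv sharedGain
  rw [Finset.sum_filter, Finset.sum_filter, ← Finset.sum_add_distrib]
  refine Finset.sum_congr rfl fun f _ => ?_
  have htwo : (2 : ℝ) - 1 = 1 := by norm_num
  cases h0 : A f 0 <;> cases h1 : A f 1 <;>
    simp [prunedDeg_fin_two, h0, h1, htwo]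

theorem Dset_fin_two_zero (π : Equiv.Perm (Fin 2)) : Dset π 0 = ∅ := by
  simp [Dset]

theorem Dset_fin_two_one (π : Equiv.Perm (Fin 2)) : Dset π 1 = {π 0} := by
  have hfilter : Finset.univ.filter (fun j : Fin 2 => j < 1) = {0} := by decide
  rw [Dset, hfilter, Finset.image_singleton]

theorem Theta_fin_two {F : ℕ} (lam : ℝ) (A : Fin F → Fin 2 → Bool) (π : Equiv.Perm (Fin 2)) :
    Theta lam A π = gamma lam A ∅ (π 0) ^ 2 + gamma lam A {π 0} (π 1) ^ 2 := by
  rw [Theta, Fin.sum_univ_two, detSINR, detSINR, Dset_fin_two_zero, Dset_fin_two_one]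

/-- Proposition 1, sufficiency, two users: if `γ_1^{(∅)} ≤ γ_2^{(∅)}` then
detecting user 1 first gives `Θ_{π₁} ≥ Θ_{π₂}`. -/
theorem stmt_7 {F : ℕ} (lam : ℝ) (hlam : 0 < lam) (A : Fin F → Fin 2 → Bool)
    (h : gamma lam A (∅ : Finset (Fin 2)) 0 ≤ gamma lam A (∅ : Finset (Fin 2)) 1) :
    Theta lam A (Equiv.refl (Fin 2)) ≥ Theta lam A (Equiv.swap 0 1) := by
  rw [Theta_fin_two, Theta_fin_two, Equiv.swap_apply_left, Equiv.swap_apply_right,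
    Equiv.refl_apply, Equiv.refl_apply, gamma_singleton_one_zero, gamma_singleton_zero_one]
  nlinarith [mul_nonneg (sharedGain_nonneg hlam A) (sub_nonneg.mpr h)]
end

section
/- (Proposition 1, two-user 'worst-goes-first'.) Suppose V = 2 and users 1 and 2 share at least one resource, i.e., ℱ_1 ∩ ℱ_2 ≠ ∅. Then for the two detecting orders π_1 = (1,2) and π_2 = (2,1), one has Θ_{π_1} ≥ Θ_{π_2} if and only if γ_1^{(∅)} ≤ γ_2^{(∅)}; equivalently, the order (1,2) maximizes Θ_π over the two possible orders if and only if γ_1^{(∅)} ≤ γ_2^{(∅)}. -/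
open Finset

/-- The SINR increment a user gains in a two-user graph when the other user is detected first. -/
noncomputable def swapIncrement {F : ℕ} (lam : ℝ) (A : Fin F → Fin 2 → Bool) : ℝ :=
  ∑ _f ∈ Fv A 0 ∩ Fv A 1, (1 / lam - 1 / (1 + lam))

theorem swapIncrement_pos {F : ℕ} {lam : ℝ} (hlam : 0 < lam) {A : Fin F → Fin 2 → Bool}
    (hshare : (Fv A 0 ∩ Fv A 1).Nonempty) : 0 < swapIncrement lam A :=
  Finset.sum_pos (fun _ _ => sub_pos.2 (one_div_lt_one_div_of_lt hlam (by linarith))) hshare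

theorem gamma_singleton_zero {F : ℕ} (lam : ℝ) (A : Fin F → Fin 2 → Bool) :
    gamma lam A {0} 1 = gamma lam A ∅ 1 + swapIncrement lam A := by
  simp only [gamma, swapIncrement, Fv, prunedDeg, ← Finset.filter_and, Finset.sum_filter,
    ← Finset.sum_add_distrib, Finset.card_filter, Fin.sum_univ_two]
  refine Finset.sum_congr rfl fun f _ => ?_
  cases A f 0 <;> cases A f 1 <;> norm_num

theorem gamma_singleton_one {F : ℕ} (lam : ℝ) (A : Fin F → Fin 2 → Bool) :
    gamma lam A {1} 0 = gamma lam A ∅ 0 + swapIncrement lam A := by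
  simp only [gamma, swapIncrement, Fv, prunedDeg, ← Finset.filter_and, Finset.sum_filter,
    ← Finset.sum_add_distrib, Finset.card_filter, Fin.sum_univ_two]
  refine Finset.sum_congr rfl fun f _ => ?_
  cases A f 0 <;> cases A f 1 <;> norm_num

theorem Theta_refl {F : ℕ} (lam : ℝ) (A : Fin F → Fin 2 → Bool) :
    Theta lam A (Equiv.refl (Fin 2)) =
      gamma lam A ∅ 0 ^ 2 + (gamma lam A ∅ 1 + swapIncrement lam A) ^ 2 := by
  have h₀ : Dset (Equiv.refl (Fin 2)) 0 = ∅ := by decide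
  have h₁ : Dset (Equiv.refl (Fin 2)) 1 = {0} := by decide
  simp [Theta, detSINR, h₀, h₁, gamma_singleton_zero]

theorem Theta_swap {F : ℕ} (lam : ℝ) (A : Fin F → Fin 2 → Bool) :
    Theta lam A (Equiv.swap 0 1) =
      gamma lam A ∅ 1 ^ 2 + (gamma lam A ∅ 0 + swapIncrement lam A) ^ 2 := by
  have h₀ : Dset (Equiv.swap (0 : Fin 2) 1) 0 = ∅ := by decide
  have h₁ : Dset (Equiv.swap (0 : Fin 2) 1) 1 = {1} := by decide
  simp [Theta, detSINR, h₀, h₁, gamma_singleton_one]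

theorem perm_fin_two_eq : ∀ ρ : Equiv.Perm (Fin 2), ρ = Equiv.refl _ ∨ ρ = Equiv.swap 0 1 := by
  decide

/-- Proposition 1, two-user "worst-goes-first": if users 1 and 2 share a
resource, then `Θ_{π₁} ≥ Θ_{π₂} ↔ γ_1^{(∅)} ≤ γ_2^{(∅)}`; equivalently, the order (1,2)
maximizes Θ over the two possible orders iff `γ_1^{(∅)} ≤ γ_2^{(∅)}`. -/
theorem stmt_8 {F : ℕ} (lam : ℝ) (hlam : 0 < lam) (A : Fin F → Fin 2 → Bool)
    (hshare : (Fv A 0 ∩ Fv A 1).Nonempty) :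
    (Theta lam A (Equiv.refl (Fin 2)) ≥ Theta lam A (Equiv.swap 0 1) ↔
      gamma lam A (∅ : Finset (Fin 2)) 0 ≤ gamma lam A (∅ : Finset (Fin 2)) 1) ∧
    ((∀ ρ : Equiv.Perm (Fin 2), Theta lam A ρ ≤ Theta lam A (Equiv.refl (Fin 2))) ↔
      gamma lam A (∅ : Finset (Fin 2)) 0 ≤ gamma lam A (∅ : Finset (Fin 2)) 1) := by
  have key : Theta lam A (Equiv.swap 0 1) ≤ Theta lam A (Equiv.refl (Fin 2)) ↔
      gamma lam A ∅ 0 ≤ gamma lam A ∅ 1 := by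
    have hpos := swapIncrement_pos hlam hshare
    rw [Theta_refl, Theta_swap,
      ← mul_le_mul_iff_right₀ (b := gamma lam A ∅ 0) (mul_pos two_pos hpos)]
    constructor <;> intro h <;> linarith
  refine ⟨key, fun h => key.1 (h _), fun h ρ => ?_⟩
  rcases perm_fin_two_eq ρ with rfl | rfl
  · exact le_rfl
  · exact key.2 h
end
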